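/- arXiv:2402.06705 — 3 statements merged into one kernel-verified Lean document; each statement's English description precedes it below -/
import Mathlib

section
/- Let G be a finite group in which the conjugacy class size of every p'-element is prime to p, for some prime p. Then G has a normal p-complement and a normal Sylow p-subgroup; i.e., the Sylow p-subgroup of G is a direct factor of G. -/
def classSet {G : Type*} [Group G] (x : G) : Set G := {y | IsConj x y}

noncomputable def classSize {G : Type*} [Group G] (x : G) : ℕ := Nat.card (classSet x)

theorem index_cent {G : Type*} [Group G] [Finite G] (x : G) :
    (Subgroup.centralizer {x}).index = classSize x := by
  have h1 : classSet x = MulAction.orbit (ConjAct G) x := by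
    ext y
    rw [ConjAct.mem_orbit_conjAct]
    exact isConj_comm
  have h2 := Nat.card_congr (MulAction.orbitProdStabilizerEquivGroup (ConjAct G) x)
  rw [Nat.card_prod, ← Subgroup.nat_card_centralizer_nat_card_stabilizer, ← h1] at h2
  have h3 := (Subgroup.centralizer {x}).card_mul_index
  have h4 : Nat.card (ConjAct G) = Nat.card G := rfl
  rw [h4, ← h3, mul_comm] at h2
  exact (Nat.eq_of_mul_eq_mul_left Nat.card_pos h2).symm

theorem exists_sylow_cent {G : Type*} [Group G] [Finite G] (p : ℕ) [Fact p.Prime] (x : G)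
    (hx : ¬ p ∣ classSize x) (z : G) (hz : z * x = x * z) (k : ℕ) (hk : z ^ p ^ k = 1) :
    ∃ Q : Sylow p G, z ∈ Q ∧ ∀ q ∈ Q, q * x = x * q := by
  let C := Subgroup.centralizer {x}
  have hzC : z ∈ C := Subgroup.mem_centralizer_singleton_iff.2 hz
  have hK : IsPGroup p (Subgroup.zpowers (⟨z, hzC⟩ : C)) := by
    rintro ⟨y, n, rfl⟩
    refine ⟨k, ?_⟩
    ext
    simp only [Subgroup.coe_pow, Subgroup.coe_zpow, Subgroup.coe_one]
    rw [← zpow_natCast, zpow_comm, zpow_natCast, hk, one_zpow]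
  obtain ⟨R, hR⟩ := hK.exists_le_sylow
  have hi : ¬ p ∣ ((R : Subgroup C).map C.subtype).index := by
    rw [Subgroup.index_map_subtype, (Fact.out : p.Prime).dvd_mul, index_cent]
    exact not_or.2 ⟨R.not_dvd_index, hx⟩
  refine ⟨(R.isPGroup'.map C.subtype).toSylow hi, ?_, ?_⟩
  · exact ⟨⟨z, hzC⟩, hR (Subgroup.mem_zpowers _), rfl⟩
  · rintro _ ⟨q, -, rfl⟩
    exact Subgroup.mem_centralizer_singleton_iff.1 q.2

theorem subsingleton_of_fixed {G X : Type*} [Group G] [Finite G] [Finite X] [MulAction G X]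
    [MulAction.IsPretransitive G X] (h : ∀ g : G, ∃ x : X, g • x = x) : Subsingleton X := by
  classical
  cases nonempty_fintype G
  cases nonempty_fintype X
  obtain ⟨x0, -⟩ := h 1
  have hb := MulAction.sum_card_fixedBy_eq_card_orbits_mul_card_group G X
  have h1 : Fintype.card (Quotient (MulAction.orbitRel G X)) = 1 := by
    rw [Fintype.card_eq_one_iff]
    refine ⟨Quotient.mk _ x0, fun y => ?_⟩
    induction y using Quotient.inductionOn with
    | _ y => exact Quotient.sound (MulAction.exists_smul_eq G x0 y)
  rw [h1, one_mul] at hb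
  by_contra hX
  rw [not_subsingleton_iff_nontrivial] at hX
  have hlt : ∑ g : G, 1 < ∑ g : G, Fintype.card (MulAction.fixedBy X g) := by
    apply Finset.sum_lt_sum
    · intro g _
      obtain ⟨x, hx⟩ := h g
      exact Fintype.card_pos_iff.2 ⟨⟨x, hx⟩⟩
    · refine ⟨1, Finset.mem_univ _, ?_⟩
      rw [Fintype.one_lt_card_iff]
      obtain ⟨a, b, hab⟩ := exists_pair_ne X
      exact ⟨⟨a, one_smul _ a⟩, ⟨b, one_smul _ b⟩, fun h => hab (congrArg Subtype.val h)⟩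
  rw [hb] at hlt
  simp at hlt

theorem stmt5 {G : Type*} [Group G] [Finite G] (p : ℕ) (hp : p.Prime)
    (h : ∀ x : G, ¬ p ∣ orderOf x → ¬ p ∣ classSize x) :
    ∃ (P : Sylow p G) (H : Subgroup G), (P : Subgroup G).Normal ∧ H.Normal ∧
      (∀ h ∈ H, ¬ p ∣ orderOf h) ∧ Disjoint (P : Subgroup G) H ∧
      (P : Subgroup G) ⊔ H = ⊤ := by
  have : Fact p.Prime := ⟨hp⟩
  have hs : Subsingleton (Sylow p G) := by
    apply subsingleton_of_fixed (G := G)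
    intro g
    obtain ⟨a, m, hm, hg⟩ := Nat.exists_eq_pow_mul_and_not_dvd (orderOf_pos g).ne' p hp.ne_one
    have hy : ¬ p ∣ orderOf (g ^ p ^ a) := by
      intro hd
      refine hm (hd.trans (orderOf_dvd_of_pow_eq_one ?_))
      rw [← pow_mul, ← hg, pow_orderOf_eq_one]
    obtain ⟨Q, hzQ, hQ⟩ := exists_sylow_cent p (g ^ p ^ a) (h _ hy) (g ^ m)
      (by rw [← pow_add, ← pow_add, add_comm]) a
      (by rw [← pow_mul, mul_comm, ← hg, pow_orderOf_eq_one])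
    refine ⟨Q, ?_⟩
    rw [← MulAction.mem_stabilizer_iff]
    have e1 : g ^ m ∈ MulAction.stabilizer G Q := by
      rw [Sylow.stabilizer_eq_normalizer]
      exact Subgroup.le_normalizer hzQ
    have e2 : g ^ p ^ a ∈ MulAction.stabilizer G Q := by
      rw [Sylow.stabilizer_eq_normalizer]
      refine Subgroup.centralizer_le_normalizer _ ?_
      exact Subgroup.mem_centralizer_iff.2 hQ
    have hc : Nat.gcd m (p ^ a) = 1 :=
      (Nat.Coprime.pow_left a ((Nat.Prime.coprime_iff_not_dvd hp).2 hm)).symm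
    have hbz := Nat.gcd_eq_gcd_ab m (p ^ a)
    rw [hc] at hbz
    have : g = (g ^ m) ^ (Nat.gcdA m (p ^ a)) * (g ^ p ^ a) ^ (Nat.gcdB m (p ^ a)) := by
      rw [← zpow_natCast g m, ← zpow_natCast g (p ^ a), ← zpow_mul, ← zpow_mul, ← zpow_add, ← hbz]
      simp
    rw [this]
    exact mul_mem (zpow_mem e1 _) (zpow_mem e2 _)
  obtain ⟨P⟩ : Nonempty (Sylow p G) := inferInstance
  have hPn : (P : Subgroup G).Normal := P.normal_of_subsingleton
  have hcent : ∀ x : G, ¬ p ∣ orderOf x → ∀ q ∈ P, q * x = x * q := by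
    intro x hx
    obtain ⟨Q, -, hQ⟩ := exists_sylow_cent p x (h x hx) 1 (by simp) 0 (by simp)
    rwa [Subsingleton.elim P Q]
  obtain ⟨H, hH⟩ := Subgroup.exists_right_complement'_of_coprime (N := (P : Subgroup G))
    P.card_coprime_index
  have hH' : ∀ h ∈ H, ¬ p ∣ orderOf h := by
    intro x hx hd
    have h1 : orderOf x ∣ Nat.card H := Subgroup.orderOf_dvd_natCard H hx
    have h2 := hH.symm.index_eq_card
    exact P.not_dvd_index (h2 ▸ hd.trans h1)
  refine ⟨P, H, hPn, ?_, hH', hH.disjoint, hH.sup_eq_top⟩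
  rw [← Subgroup.normalizer_eq_top_iff, eq_top_iff, ← hH.sup_eq_top]
  refine sup_le (fun q hq => ?_) Subgroup.le_normalizer
  refine Subgroup.centralizer_le_normalizer _ ?_
  exact Subgroup.mem_centralizer_iff.2 fun x hx => (hcent x (hH' x hx) q hq).symm
end

section
/- Let G be a finite π-separable group such that the conjugacy class size of every π-element of G is a π-number. Then G = H × K where H is a Hall π-subgroup and K is a π-complement (Hall π'-subgroup) of G. -/
/-- `n` is a `π`-number: every prime divisor of `n` lies in `π`. -/
def IsPiNumber (π : Set ℕ) (n : ℕ) : Prop := ∀ p : ℕ, p.Prime → p ∣ n → p ∈ π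

/-- `G` is `π`-separable: it has a normal series each of whose factors is a
`π`-group or a `π'`-group (the factor condition is expressed elementwise). -/
def IsPiSeparable (π : Set ℕ) (G : Type*) [Group G] : Prop :=
  ∃ (n : ℕ) (c : Fin (n + 1) → Subgroup G),
    c 0 = ⊥ ∧ c (Fin.last n) = ⊤ ∧
    (∀ i : Fin n, c i.castSucc ≤ c i.succ) ∧
    (∀ i : Fin n, (c i.castSucc).Normal) ∧
    (∀ i : Fin n,
      (∀ x ∈ c i.succ, ∃ m : ℕ, m ≠ 0 ∧ IsPiNumber π m ∧ x ^ m ∈ c i.castSucc) ∨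
      (∀ x ∈ c i.succ, ∃ m : ℕ, m ≠ 0 ∧ IsPiNumber πᶜ m ∧ x ^ m ∈ c i.castSucc))

namespace PiSep

lemma _root_.IsPiNumber.dvd {σ : Set ℕ} {m n : ℕ} (h : IsPiNumber σ n) (hd : m ∣ n) : IsPiNumber σ m :=
  fun p hp hpm => h p hp (hpm.trans hd)

lemma _root_.IsPiNumber.mul {σ : Set ℕ} {m n : ℕ} (h : IsPiNumber σ m) (h' : IsPiNumber σ n) :
    IsPiNumber σ (m * n) :=
  fun p hp hpm => (hp.dvd_mul.1 hpm).elim (h p hp) (h' p hp)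

lemma _root_.IsPiNumber.coprime {σ : Set ℕ} {m n : ℕ} (h : IsPiNumber σ m) (h' : IsPiNumber σᶜ n) :
    Nat.Coprime m n :=
  Nat.coprime_of_dvd fun p hp hm hn => h' p hp hn (h p hp hm)

lemma _root_.IsPiNumber.eq_one {σ : Set ℕ} {n : ℕ} (h : IsPiNumber σ n) (h' : IsPiNumber σᶜ n) :
    n = 1 := by simpa using IsPiNumber.coprime h h'

lemma card_pi {G : Type*} [Group G] [Finite G] {σ : Set ℕ}
    (h : ∀ x : G, IsPiNumber σ (orderOf x)) : IsPiNumber σ (Nat.card G) := by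
  intro p hp hd
  have := Fact.mk hp
  obtain ⟨x, hx⟩ := exists_prime_orderOf_dvd_card' p hd
  exact h x p hp (by rw [hx])

lemma card_pi' {G : Type*} [Group G] [Finite G] {σ : Set ℕ} {H : Subgroup G}
    (h : ∀ x ∈ H, IsPiNumber σ (orderOf x)) : IsPiNumber σ (Nat.card H) :=
  card_pi fun x => by
    have := h x x.2
    rwa [Subgroup.orderOf_coe] at this

lemma elem_pi {G : Type*} [Group G] [Finite G] {σ : Set ℕ} {H : Subgroup G}
    (h : IsPiNumber σ (Nat.card H)) : ∀ x ∈ H, IsPiNumber σ (orderOf x) :=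
  fun x hx => h.dvd (Subgroup.orderOf_dvd_natCard H hx)

lemma relIndex_dvd {G : Type*} [Group G] [Finite G] (H K : Subgroup G) [K.Normal] :
    H.relIndex K ∣ H.index := by
  have h1 := Subgroup.relIndex_mul_index (inf_le_right : H ⊓ K ≤ K)
  have h2 := Subgroup.relIndex_mul_index (inf_le_left : H ⊓ K ≤ H)
  have h3 := Subgroup.relIndex_mul_index (le_sup_right : K ≤ H ⊔ K)
  rw [Subgroup.inf_relIndex_right] at h1
  rw [Subgroup.inf_relIndex_left] at h2
  rw [Subgroup.relIndex_sup_right] at h3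
  have h0 : 0 < K.relIndex H := Nat.pos_of_ne_zero (Subgroup.FiniteIndex.index_ne_zero (H := K.subgroupOf H))
  refine ⟨(H ⊔ K).index, Nat.eq_of_mul_eq_mul_left h0 ?_⟩
  rw [h2, ← h1, ← h3]; ring

lemma classSize_eq {G : Type*} [Group G] (x : G) :
    classSize x = (Subgroup.centralizer {x}).index := by
  have h1 : classSet x = MulAction.orbit (ConjAct G) x := by
    ext y
    rw [ConjAct.mem_orbit_conjAct, isConj_comm]
    rfl
  obtain ⟨f, hf⟩ : ∃ f : G →* ConjAct G, ∀ g, f g = ConjAct.toConjAct g :=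
    ⟨(ConjAct.toConjAct : G ≃* ConjAct G), fun _ => rfl⟩
  have hs : Function.Surjective f := fun y => ⟨ConjAct.ofConjAct y, by rw [hf]; rfl⟩
  have h2 : (Subgroup.centralizer {x}) = (MulAction.stabilizer (ConjAct G) x).comap f := by
    ext g
    rw [Subgroup.mem_centralizer_singleton_iff, Subgroup.mem_comap, MulAction.mem_stabilizer_iff,
      hf, ConjAct.smul_def, ConjAct.ofConjAct_toConjAct, mul_inv_eq_iff_eq_mul]
  rw [classSize, h1, h2, Subgroup.index_comap_of_surjective _ hs, MulAction.index_stabilizer]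
  rfl

lemma inherit {G : Type*} [Group G] [Finite G] {π : Set ℕ}
    (h : ∀ x : G, IsPiNumber π (orderOf x) → IsPiNumber π (classSize x))
    (N : Subgroup G) [N.Normal] (x : N) (hx : IsPiNumber π (orderOf x)) :
    IsPiNumber π (classSize x) := by
  have h1 := h (x : G) (by rwa [Subgroup.orderOf_coe])
  rw [classSize_eq] at h1 ⊢
  have : Subgroup.centralizer {x} = (Subgroup.centralizer {(x : G)}).subgroupOf N := by
    ext g
    simp [Subgroup.mem_centralizer_singleton_iff, Subgroup.mem_subgroupOf, Subtype.ext_iff]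
  rw [this]
  exact h1.dvd (relIndex_dvd _ N)

/-- A finite group is not the union of the conjugates of a proper subgroup. -/
lemma cover {A : Type*} [Group A] [Finite A] (H : Subgroup A)
    (h : ∀ a : A, ∃ b : A, b * a * b⁻¹ ∈ H) : H = ⊤ := by
  classical
  let := Fintype.ofFinite A
  let := Fintype.ofFinite (A ⧸ H)
  let : Fintype (Quotient (MulAction.orbitRel A (A ⧸ H))) := Fintype.ofFinite _
  have key := MulAction.sum_card_fixedBy_eq_card_orbits_mul_card_group A (A ⧸ H)
  have h1 : Fintype.card (Quotient (MulAction.orbitRel A (A ⧸ H))) = 1 := by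
    rw [Fintype.card_eq_one_iff_nonempty_unique]
    exact ⟨(MulAction.pretransitive_iff_unique_quotient_of_nonempty A (A ⧸ H)).1 inferInstance |>.some⟩
  rw [h1, one_mul] at key
  have hpos : ∀ g ∈ (Finset.univ : Finset A),
      1 ≤ Fintype.card (MulAction.fixedBy (A ⧸ H) g) := by
    intro g _
    obtain ⟨b, hb⟩ := h g
    refine Fintype.card_pos_iff.2 ⟨⟨((b⁻¹ : A) : A ⧸ H), ?_⟩⟩
    rw [MulAction.mem_fixedBy]
    change ((g * b⁻¹ : A) : A ⧸ H) = _
    rw [eq_comm, QuotientGroup.eq]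
    simpa [mul_assoc] using hb
  have hsum : ∑ g : A, 1 = ∑ g : A, Fintype.card (MulAction.fixedBy (A ⧸ H) g) := by
    rw [key]; simp
  have := (Finset.sum_eq_sum_iff_of_le hpos).1 hsum 1 (Finset.mem_univ _)
  have h2 : Fintype.card (MulAction.fixedBy (A ⧸ H) (1 : A)) = Fintype.card (A ⧸ H) := by
    apply Fintype.card_congr
    exact (Equiv.subtypeUnivEquiv (fun x => by rw [MulAction.mem_fixedBy, one_smul]))
  rw [h2] at this
  rw [← Subgroup.index_eq_one, Subgroup.index, Nat.card_eq_fintype_card, ← this]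

/-- a `p`-subgroup fixes a point of a class of size prime to `p`. -/
lemma fixedClass {G : Type*} [Group G] [Finite G] {p : ℕ} [Fact p.Prime] (P : Subgroup G)
    (hP : IsPGroup p P) (a : G) (ha : ¬ p ∣ classSize a) :
    ∃ x, IsConj a x ∧ ∀ g ∈ P, g * x = x * g := by
  let : MulAction P (classSet a) :=
    { smul := fun g x => ⟨(g : G) * x * (g : G)⁻¹,
        (show IsConj a x from x.2).trans (isConj_iff.2 ⟨g, rfl⟩)⟩
      one_smul := fun x => Subtype.ext (show ((1 : P) : G) * x * ((1 : P) : G)⁻¹ = x by simp)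
      mul_smul := fun g k x => Subtype.ext
        (show ((g * k : P) : G) * x * ((g * k : P) : G)⁻¹ =
          (g : G) * ((k : G) * x * (k : G)⁻¹) * (g : G)⁻¹ by simp [mul_assoc]) }
  obtain ⟨x, hx⟩ := hP.nonempty_fixed_point_of_prime_not_dvd_card (classSet a) ha
  refine ⟨x, x.2, fun g hg => ?_⟩
  have h1 : g * (x : G) * g⁻¹ = x := congrArg Subtype.val (hx ⟨g, hg⟩)
  exact mul_inv_eq_iff_eq_mul.1 h1

lemma pgroup_centralizes {G : Type*} [Group G] [Finite G] {π : Set ℕ}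
    (h : ∀ x : G, IsPiNumber π (orderOf x) → IsPiNumber π (classSize x))
    (A : Subgroup G) [A.Normal] (hA : ∀ x ∈ A, IsPiNumber π (orderOf x))
    (hi : IsPiNumber πᶜ A.index) {p : ℕ} [Fact p.Prime] (hp : p ∉ π) (P : Subgroup G)
    (hP : IsPGroup p P) : P ≤ Subgroup.centralizer (A : Set G) := by
  have hcov : (Subgroup.centralizer (P : Set G)).subgroupOf A = ⊤ := by
    apply cover
    rintro ⟨a, ha⟩
    have hcs := h a (hA a ha)
    obtain ⟨x, hx, hxP⟩ := fixedClass P hP a (fun hd => hp (hcs p Fact.out hd))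
    obtain ⟨g, hg⟩ := isConj_iff.1 hx
    have htop : A ⊔ Subgroup.centralizer {a} = ⊤ := by
      rw [← Subgroup.index_eq_one]
      rw [classSize_eq] at hcs
      exact IsPiNumber.eq_one (hcs.dvd (Subgroup.index_dvd_of_le le_sup_right))
        (hi.dvd (Subgroup.index_dvd_of_le le_sup_left))
    have hgm : g ∈ A ⊔ Subgroup.centralizer {a} := htop ▸ Subgroup.mem_top g
    rw [Subgroup.mem_sup_of_normal_left] at hgm
    obtain ⟨b, hb, c, hc, rfl⟩ := hgm
    rw [Subgroup.mem_centralizer_singleton_iff] at hc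
    have hx' : b * a * b⁻¹ = x := by
      rw [← hg, mul_inv_rev]
      calc b * a * b⁻¹ = b * (a * c) * c⁻¹ * b⁻¹ := by group
        _ = b * (c * a) * c⁻¹ * b⁻¹ := by rw [hc]
        _ = _ := by group
    refine ⟨⟨b, hb⟩, ?_⟩
    rw [Subgroup.mem_subgroupOf, Subgroup.mem_centralizer_iff]
    change ∀ k ∈ (P : Set G), k * (b * a * b⁻¹) = (b * a * b⁻¹) * k
    rw [hx']
    exact hxP
  rw [Subgroup.subgroupOf_eq_top] at hcov
  exact Subgroup.le_centralizer_iff.1 hcov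

lemma compl_centralizes {G : Type*} [Group G] [Finite G] {π : Set ℕ}
    (h : ∀ x : G, IsPiNumber π (orderOf x) → IsPiNumber π (classSize x))
    (A : Subgroup G) [A.Normal] (hA : ∀ x ∈ A, IsPiNumber π (orderOf x))
    (hi : IsPiNumber πᶜ A.index) (K : Subgroup G) (hK : IsPiNumber πᶜ (Nat.card K)) :
    K ≤ Subgroup.centralizer (A : Set G) := by
  rw [← Subgroup.relIndex_eq_one]
  by_contra hne
  obtain ⟨p, hp, hd⟩ := Nat.exists_prime_and_dvd hne
  have := Fact.mk hp
  have hpπ : p ∉ π := hK p hp (hd.trans (Subgroup.relIndex_dvd_card _ _))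
  let P : Sylow p K := default
  have h1 := pgroup_centralizes h A hA hi hpπ (P.1.map K.subtype) (P.2.map _)
  have h2 : P.1 ≤ (Subgroup.centralizer (A : Set G)).subgroupOf K :=
    Subgroup.map_le_iff_le_comap.1 h1
  exact P.not_dvd_index (hd.trans (Subgroup.index_dvd_of_le h2))

/-- A normal Hall subgroup with a centralizing complement. -/
lemma finish {G : Type*} [Group G] [Finite G] {σ : Set ℕ} (A : Subgroup G) [A.Normal]
    (hA : ∀ x ∈ A, IsPiNumber σ (orderOf x)) (hi : IsPiNumber σᶜ A.index)
    (hc : ∀ K : Subgroup G, IsPiNumber σᶜ (Nat.card K) → K ≤ Subgroup.centralizer (A : Set G)) :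
    ∃ K : Subgroup G, K.Normal ∧ Disjoint A K ∧ A ⊔ K = ⊤ ∧
      (∀ x ∈ K, IsPiNumber σᶜ (orderOf x)) ∧ IsPiNumber σ K.index := by
  obtain ⟨K, hK⟩ := Subgroup.exists_right_complement'_of_coprime
    (IsPiNumber.coprime (card_pi' hA) hi)
  have hcard : IsPiNumber σᶜ (Nat.card K) := by rwa [← hK.symm.index_eq_card]
  have hcen := hc K hcard
  refine ⟨K, ?_, hK.disjoint, hK.sup_eq_top, elem_pi hcard, ?_⟩
  · rw [← Subgroup.normalizer_eq_top_iff, eq_top_iff, ← hK.sup_eq_top]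
    refine sup_le ?_ Subgroup.le_normalizer
    exact (Subgroup.le_centralizer_iff.1 hcen).trans (Subgroup.centralizer_le_normalizer _)
  · rw [hK.index_eq_card]; exact card_pi' hA

def Concl (π : Set ℕ) (G : Type*) [Group G] : Prop :=
  ∃ H K : Subgroup G, H.Normal ∧ K.Normal ∧ Disjoint H K ∧ H ⊔ K = ⊤ ∧
      (∀ x ∈ H, IsPiNumber π (orderOf x)) ∧ IsPiNumber πᶜ H.index ∧
      (∀ x ∈ K, IsPiNumber πᶜ (orderOf x)) ∧ IsPiNumber π K.index

lemma concl_of_pi {G : Type*} [Group G] [Finite G] {π : Set ℕ}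
    (h : ∀ x : G, IsPiNumber π (orderOf x) → IsPiNumber π (classSize x))
    (A : Subgroup G) (hn : A.Normal) (hA : ∀ x ∈ A, IsPiNumber π (orderOf x))
    (hi : IsPiNumber πᶜ A.index) : Concl π G := by
  obtain ⟨K, h1, h2, h3, h4, h5⟩ := finish A hA hi (compl_centralizes h A hA hi)
  exact ⟨A, K, hn, h1, h2, h3, hA, hi, h4, h5⟩

lemma concl_of_pi' {G : Type*} [Group G] [Finite G] {π : Set ℕ}
    (h : ∀ x : G, IsPiNumber π (orderOf x) → IsPiNumber π (classSize x))
    (B : Subgroup G) (hn : B.Normal) (hB : ∀ x ∈ B, IsPiNumber πᶜ (orderOf x))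
    (hi : IsPiNumber π B.index) : Concl π G := by
  obtain ⟨K, h1, h2, h3, h4, h5⟩ := finish (σ := πᶜ) B hB (by rwa [compl_compl]) (by
    intro K hK x hx
    rw [compl_compl] at hK
    have hcs := h x (elem_pi hK x hx)
    rw [classSize_eq] at hcs
    have hle : B ≤ Subgroup.centralizer {x} := by
      rw [← Subgroup.relIndex_eq_one]
      exact IsPiNumber.eq_one (hcs.dvd (relIndex_dvd _ B))
        ((card_pi' hB).dvd (Subgroup.relIndex_dvd_card _ _))
    rw [Subgroup.mem_centralizer_iff]
    intro b hb
    exact (Subgroup.mem_centralizer_singleton_iff.1 (hle hb)))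
  rw [compl_compl] at h4
  exact ⟨K, B, h1, hn, h2.symm, by rw [sup_comm, h3], h4, h5, hB, hi⟩

/-- A normal Hall subgroup of a normal subgroup is normal. -/
lemma normal_map {G : Type*} [Group G] [Finite G] {σ : Set ℕ} (N : Subgroup G) [N.Normal]
    (A : Subgroup N) (hn : A.Normal) (hA : ∀ x ∈ A, IsPiNumber σ (orderOf x))
    (hi : IsPiNumber σᶜ A.index) :
    (A.map N.subtype).Normal ∧ (∀ x ∈ A.map N.subtype, IsPiNumber σ (orderOf x)) ∧
      (A.map N.subtype).index = A.index * N.index := by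
  have hmem : ∀ x : N, IsPiNumber σ (orderOf x) → x ∈ A := by
    intro x hx
    rw [← QuotientGroup.eq_one_iff, ← orderOf_eq_one_iff]
    exact IsPiNumber.eq_one (hx.dvd (orderOf_map_dvd (QuotientGroup.mk' A) x))
      (hi.dvd (orderOf_dvd_natCard _))
  have hord : ∀ x ∈ A.map N.subtype, IsPiNumber σ (orderOf x) := by
    rintro _ ⟨x, hx, rfl⟩
    have := hA x hx
    rwa [← Subgroup.orderOf_coe] at this
  refine ⟨⟨fun x hx g => ?_⟩, hord, ?_⟩
  · have hxo := hord x hx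
    obtain ⟨y, hy, rfl⟩ := hx
    have hN : g * (y : G) * g⁻¹ ∈ N := Subgroup.Normal.conj_mem inferInstance _ y.2 g
    refine ⟨⟨_, hN⟩, hmem _ ?_, rfl⟩
    rw [← Subgroup.orderOf_coe]
    have : orderOf (g * (y : G) * g⁻¹) = orderOf (y : G) := 
      orderOf_injective (MulAut.conj g).toMonoidHom (MulAut.conj g).injective (y : G)
    rw [this]
    exact hxo
  · rw [← Subgroup.relIndex_mul_index (Subgroup.map_subtype_le A), Subgroup.relIndex,
      Subgroup.subgroupOf, Subgroup.comap_map_eq_self_of_injective N.subtype_injective]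

lemma index_pi {G : Type*} [Group G] [Finite G] {σ : Set ℕ} (N : Subgroup G) [N.Normal]
    (h : ∀ x : G, ∃ m : ℕ, m ≠ 0 ∧ IsPiNumber σ m ∧ x ^ m ∈ N) : IsPiNumber σ N.index := by
  apply card_pi
  intro x
  obtain ⟨x, rfl⟩ := QuotientGroup.mk_surjective x
  obtain ⟨m, -, hm, hx⟩ := h x
  refine hm.dvd (orderOf_dvd_of_pow_eq_one ?_)
  rw [← QuotientGroup.mk_pow, QuotientGroup.eq_one_iff]
  exact hx

universe u

lemma main (π : Set ℕ) (n : ℕ) : ∀ {G : Type u} [Group G] [Finite G]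
    (_ : ∀ x : G, IsPiNumber π (orderOf x) → IsPiNumber π (classSize x))
    (c : Fin (n + 1) → Subgroup G) (_ : c 0 = ⊥) (_ : c (Fin.last n) = ⊤)
    (_ : ∀ i : Fin n, c i.castSucc ≤ c i.succ)
    (_ : ∀ i : Fin n, (c i.castSucc).Normal)
    (_ : ∀ i : Fin n,
      (∀ x ∈ c i.succ, ∃ m : ℕ, m ≠ 0 ∧ IsPiNumber π m ∧ x ^ m ∈ c i.castSucc) ∨
      (∀ x ∈ c i.succ, ∃ m : ℕ, m ≠ 0 ∧ IsPiNumber πᶜ m ∧ x ^ m ∈ c i.castSucc)),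
    Concl π G := by
  induction n with
  | zero =>
    intro G _ _ h c h0 h1 _ _ _
    have hbt : (⊥ : Subgroup G) = ⊤ := h0.symm.trans h1
    refine concl_of_pi h ⊥ inferInstance ?_ ?_
    · intro x hx p hp hd
      rw [Subgroup.mem_bot.1 hx, orderOf_one] at hd
      exact absurd (Nat.dvd_one.1 hd) hp.ne_one
    · intro p hp hd
      rw [hbt, Subgroup.index_top] at hd
      exact absurd (Nat.dvd_one.1 hd) hp.ne_one
  | succ n ih =>
    intro G _ _ h c h0 h1 hle hn hf
    have hN : (c (Fin.last n).castSucc).Normal := hn (Fin.last n)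
    set N := c (Fin.last n).castSucc with hNdef
    have hC : Concl π N := by
      refine ih (G := N) (inherit h N) (fun i => (c i.castSucc).subgroupOf N) ?_ ?_ ?_ ?_ ?_
      · simp [h0]
      · simp [hNdef]
      · intro i x hx
        exact hle i.castSucc hx
      · intro i
        have := hn i.castSucc
        exact Subgroup.normal_subgroupOf
      · intro i
        refine (hf i.castSucc).imp (fun H x hx => ?_) (fun H x hx => ?_)
        · exact H x hx
        · exact H x hx
    obtain ⟨A, B, hAn, hBn, -, -, hA, hAi, hB, hBi⟩ := hC
    have hlast : ∀ x : G, x ∈ c (Fin.last n).succ := by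
      intro x
      rw [Fin.succ_last, h1]
      trivial
    rcases hf (Fin.last n) with H | H
    · have hNi : IsPiNumber π N.index := index_pi N fun x => H x (hlast x)
      obtain ⟨e1, e2, e3⟩ := normal_map N B hBn hB (by rwa [compl_compl])
      exact concl_of_pi' h _ e1 e2 (by rw [e3]; exact hBi.mul hNi)
    · have hNi : IsPiNumber πᶜ N.index := index_pi N fun x => H x (hlast x)
      obtain ⟨e1, e2, e3⟩ := normal_map N A hAn hA hAi
      exact concl_of_pi h _ e1 e2 (by rw [e3]; exact hAi.mul hNi)

end PiSep

theorem stmt6 {G : Type*} [Group G] [Finite G] (π : Set ℕ)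
    (hsep : IsPiSeparable π G)
    (h : ∀ x : G, IsPiNumber π (orderOf x) → IsPiNumber π (classSize x)) :
    ∃ H K : Subgroup G, H.Normal ∧ K.Normal ∧ Disjoint H K ∧ H ⊔ K = ⊤ ∧
      (∀ x ∈ H, IsPiNumber π (orderOf x)) ∧ IsPiNumber πᶜ H.index ∧
      (∀ x ∈ K, IsPiNumber πᶜ (orderOf x)) ∧ IsPiNumber π K.index := by
  obtain ⟨n, c, h0, h1, hle, hn, hf⟩ := hsep
  exact PiSep.main π n h c h0 h1 hle hn hf
end

section
/- Let G be a finite group, N ⊴ G, and x, y ∈ N noncentral in G such that every G-conjugacy class of N has size coprime to |x^G| or to |y^G| (so in particular gcd(|x^G|, |y^G|) = 1). If x and y are both p-elements for the same prime p, then p divides |x^G| or p divides |y^G|. -/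
theorem classSize_eq {G : Type*} [Group G] (x : G) :
    classSize x = (Subgroup.centralizer {x}).index := by
  have h1 : classSet x = MulAction.orbit (ConjAct G) x := by
    ext z
    rw [ConjAct.mem_orbit_conjAct]
    exact isConj_comm
  unfold classSize
  rw [h1, Nat.card_coe_set_eq, ← MulAction.index_stabilizer, ConjAct.stabilizer_eq_centralizer]
  rfl

theorem inf_index {G : Type*} [Group G] [Finite G] (H K : Subgroup G)
    (h : Nat.Coprime H.index K.index) : (H ⊓ K).index = H.index * K.index := by
  apply le_antisymm (Subgroup.index_inf_le (H := H) (K := K))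
  apply Nat.le_of_dvd
  · exact Nat.pos_of_ne_zero Subgroup.index_ne_zero_of_finite
  · exact h.mul_dvd_of_dvd_of_dvd (Subgroup.index_dvd_of_le inf_le_left)
      (Subgroup.index_dvd_of_le inf_le_right)

theorem isConj_conj {G : Type*} [Group G] (g x z : G) (h : IsConj x z) :
    IsConj x (g * z * g⁻¹) := h.trans (isConj_iff.2 ⟨g, rfl⟩)

theorem simul_conj {G : Type*} [Group G] [Finite G] (x y : G)
    (h : Nat.Coprime (classSize x) (classSize y)) (x' y' : G) (hx : IsConj x x')
    (hy : IsConj y y') : ∃ g : G, g * x * g⁻¹ = x' ∧ g * y * g⁻¹ = y' := by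
  let H := Subgroup.centralizer {x} ⊓ Subgroup.centralizer {y}
  have hH : H.index = classSize x * classSize y := by
    rw [classSize_eq, classSize_eq] at *
    exact inf_index _ _ h
  let f : G ⧸ H → classSet x × classSet y := Quotient.lift
    (fun g => (⟨g * x * g⁻¹, isConj_conj g x x (IsConj.refl x)⟩,
      ⟨g * y * g⁻¹, isConj_conj g y y (IsConj.refl y)⟩)) (by
      intro a b hab
      have hab' : a⁻¹ * b ∈ H := QuotientGroup.leftRel_apply.1 hab
      obtain ⟨h1, h2⟩ := hab'
      have h1' := Subgroup.mem_centralizer_singleton_iff.1 h1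
      have h2' := Subgroup.mem_centralizer_singleton_iff.1 h2
      have e : ∀ t : G, a⁻¹ * b * t = t * (a⁻¹ * b) → a * t * a⁻¹ = b * t * b⁻¹ := by
        intro t ht
        have : b * t = a * t * a⁻¹ * b := by
          calc b * t = a * (a⁻¹ * b * t) := by group
            _ = _ := by rw [ht]; group
        rw [this]; group
      exact Prod.ext (Subtype.ext (e x h1')) (Subtype.ext (e y h2')))
  have hinj : Function.Injective f := by
    intro a b
    induction a using QuotientGroup.induction_on with | _ a
    induction b using QuotientGroup.induction_on with | _ b
    intro hab
    have hab' : (a * x * a⁻¹ = b * x * b⁻¹) ∧ (a * y * a⁻¹ = b * y * b⁻¹) := by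
      have := Prod.ext_iff.1 hab
      exact ⟨congrArg Subtype.val this.1, congrArg Subtype.val this.2⟩
    have e : ∀ t : G, a * t * a⁻¹ = b * t * b⁻¹ → a⁻¹ * b * t = t * (a⁻¹ * b) := by
      intro t ht
      calc a⁻¹ * b * t = a⁻¹ * (b * t * b⁻¹) * b := by group
        _ = _ := by rw [← ht]; group
    apply QuotientGroup.eq.2
    exact ⟨Subgroup.mem_centralizer_singleton_iff.2 (e x hab'.1),
      Subgroup.mem_centralizer_singleton_iff.2 (e y hab'.2)⟩
  have hbij : Function.Bijective f := by
    refine (Nat.bijective_iff_injective_and_card f).2 ⟨hinj, ?_⟩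
    rw [Nat.card_prod]
    exact hH
  obtain ⟨q, hq⟩ := hbij.2 (⟨x', hx⟩, ⟨y', hy⟩)
  induction q using QuotientGroup.induction_on with | _ g
  have := Prod.ext_iff.1 hq
  exact ⟨g, congrArg Subtype.val this.1, congrArg Subtype.val this.2⟩

theorem classSize_pos {G : Type*} [Group G] [Finite G] (x : G) : 0 < classSize x := by
  rw [classSize_eq]
  exact Nat.pos_of_ne_zero Subgroup.index_ne_zero_of_finite

theorem mul_conj {G : Type*} [Group G] [Finite G] (x y : G)
    (h : Nat.Coprime (classSize x) (classSize y)) (x' y' : G) (hx : IsConj x x')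
    (hy : IsConj y y') : IsConj (x * y) (x' * y') := by
  obtain ⟨g, rfl, rfl⟩ := simul_conj x y h x' y' hx hy
  exact isConj_iff.2 ⟨g, by group⟩

theorem mul_size {G : Type*} [Group G] [Finite G] (x y : G)
    (h : Nat.Coprime (classSize x) (classSize y)) (hlt : classSize y < classSize x)
    (hc : Nat.Coprime (classSize (x * y)) (classSize x) ∨
      Nat.Coprime (classSize (x * y)) (classSize y)) :
    classSize (x * y) = classSize x := by
  have hge : classSize x ≤ classSize (x * y) := by
    refine Nat.card_le_card_of_injective
      (fun z : classSet x => (⟨z.1 * y, mul_conj x y h z.1 y z.2 (IsConj.refl y)⟩ :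
        classSet (x * y))) ?_
    intro a b hab
    have := congrArg Subtype.val hab
    exact Subtype.ext (mul_right_cancel this)
  have hdvd : classSize (x * y) ∣ classSize x * classSize y := by
    have h' := h
    rw [classSize_eq, classSize_eq] at h'
    rw [classSize_eq, classSize_eq, classSize_eq, ← inf_index _ _ h']
    apply Subgroup.index_dvd_of_le
    rintro g ⟨h1, h2⟩
    have h1' := Subgroup.mem_centralizer_singleton_iff.1 h1
    have h2' := Subgroup.mem_centralizer_singleton_iff.1 h2
    apply Subgroup.mem_centralizer_singleton_iff.2
    rw [← mul_assoc, h1', mul_assoc, h2', mul_assoc]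
  rcases hc with hc | hc
  · have := Nat.le_of_dvd (classSize_pos y) (hc.dvd_of_dvd_mul_left hdvd)
    omega
  · have := Nat.le_of_dvd (classSize_pos x) (hc.dvd_of_dvd_mul_right hdvd)
    omega

theorem isConj_inv_inv {G : Type*} [Group G] {y z : G} (h : IsConj y z) : IsConj y⁻¹ z⁻¹ := by
  obtain ⟨g, rfl⟩ := isConj_iff.1 h
  exact isConj_iff.2 ⟨g, by group⟩

theorem classSize_inv {G : Type*} [Group G] (y : G) : classSize y⁻¹ = classSize y := by
  rw [classSize_eq, classSize_eq]
  congr 1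
  ext g
  rw [Subgroup.mem_centralizer_singleton_iff, Subgroup.mem_centralizer_singleton_iff]
  exact (Commute.inv_right_iff : Commute g y⁻¹ ↔ Commute g y)

def leftStab {G : Type*} [Group G] (x : G) : Subgroup G where
  carrier := {k | ∀ z, IsConj x (k * z) ↔ IsConj x z}
  one_mem' := by intro z; rw [one_mul]
  mul_mem' := by
    intro a b ha hb z
    rw [mul_assoc, ha, hb]
  inv_mem' := by
    intro a ha z
    rw [← ha, mul_inv_cancel_left]

theorem conj_iff {G : Type*} [Group G] (g x z : G) :
    IsConj x (g * z * g⁻¹) ↔ IsConj x z :=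
  ⟨fun h => by
    have := isConj_conj g⁻¹ _ _ h
    convert this using 1
    group, isConj_conj g x z⟩

theorem leftStab_normal {G : Type*} [Group G] (x : G) : (leftStab x).Normal := by
  constructor
  intro k hk g z
  have := hk (g⁻¹ * z * g⁻¹⁻¹)
  rw [conj_iff, ← conj_iff g] at this
  convert this using 2
  group

instance leftStabAct {G : Type*} [Group G] (x : G) :
    MulAction (leftStab x) (classSet x) where
  smul k z := ⟨k.1 * z.1, (k.2 z.1).2 z.2⟩
  one_smul z := Subtype.ext (one_mul z.1)
  mul_smul a b z := Subtype.ext (mul_assoc a.1 b.1 z.1)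

theorem leftStab_card {G : Type*} [Group G] (x : G) :
    Nat.card (leftStab x) ∣ classSize x := by
  have h : ∀ b : classSet x, MulAction.stabilizer (leftStab x) b = ⊥ := by
    intro b
    rw [eq_bot_iff]
    intro k hk
    have h1 : k.1 * b.1 = b.1 := congrArg Subtype.val (MulAction.mem_stabilizer_iff.1 hk)
    exact Subgroup.mem_bot.2 (Subtype.ext (mul_eq_right.1 h1))
  have e := MulAction.selfEquivOrbitsQuotientProd h
  unfold classSize
  rw [Nat.card_congr e, Nat.card_prod]
  exact dvd_mul_left _ _

theorem card_mul_relIndex_aux {G : Type*} [Group G] {H K : Subgroup G} (h : H ≤ K) :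
    Nat.card H * H.relIndex K = Nat.card K := by
  rw [← Subgroup.relIndex_bot_left, ← Subgroup.relIndex_bot_left]
  exact Subgroup.relIndex_mul_relIndex _ _ _ bot_le h

theorem le_of_coprime_normal {G : Type*} [Group G] [Finite G] (H N : Subgroup G) (hN : N.Normal)
    (h : Nat.Coprime (Nat.card N) H.index) : N ≤ H := by
  have e1 : N.relIndex (H ⊔ N) = N.relIndex H := Subgroup.relIndex_sup_right H N
  have e2 : Nat.card N * N.relIndex (H ⊔ N) = Nat.card (H ⊔ N : Subgroup G) :=
    card_mul_relIndex_aux le_sup_right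
  have e3 : Nat.card (N ⊓ H : Subgroup G) * (N ⊓ H).relIndex H = Nat.card H :=
    card_mul_relIndex_aux inf_le_right
  have e4 : Nat.card H * H.relIndex (H ⊔ N) = Nat.card (H ⊔ N : Subgroup G) :=
    card_mul_relIndex_aux le_sup_left
  have e5 : H.relIndex (H ⊔ N) * (H ⊔ N).index = H.index :=
    Subgroup.relIndex_mul_index le_sup_left
  rw [Subgroup.inf_relIndex_right] at e3
  have hpos : 0 < N.relIndex H := by
    rcases Nat.eq_zero_or_pos (N.relIndex H) with h0 | h0
    · rw [h0, mul_zero] at e3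
      exact absurd e3.symm Nat.card_pos.ne'
    · exact h0
  have e6 : Nat.card N = Nat.card (N ⊓ H : Subgroup G) * H.relIndex (H ⊔ N) := by
    apply Nat.eq_of_mul_eq_mul_right hpos
    rw [e1, ← e4, ← e3] at e2
    rw [e2]; ring
  have e7 : H.relIndex (H ⊔ N) = 1 :=
    Nat.eq_one_of_dvd_coprimes h (Dvd.intro_left _ e6.symm) (Dvd.intro _ e5)
  exact le_sup_right.trans (Subgroup.relIndex_eq_one.1 e7)

theorem main_aux {G : Type*} [Group G] [Finite G] (N : Subgroup G)
    (p : ℕ) (hp : p.Prime) (x y : G) (hx : x ∈ N) (hy : y ∈ N)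
    (hyc : y ∉ Subgroup.center G)
    (hyp : ∃ b : ℕ, orderOf y = p ^ b)
    (hcop : Nat.Coprime (classSize x) (classSize y))
    (hlt : classSize y < classSize x)
    (hcl : ∀ z ∈ N, Nat.Coprime (classSize z) (classSize x) ∨
      Nat.Coprime (classSize z) (classSize y)) :
    p ∣ classSize x := by
  by_contra hpx
  have hs := mul_size x y hcop hlt (hcl _ (N.mul_mem hx hy))
  have hcop2 : Nat.Coprime (classSize (x * y)) (classSize y⁻¹) := by
    rw [hs, classSize_inv]; exact hcop
  have key : ∀ x' y1 y2, IsConj x x' → IsConj y y1 → IsConj y y2 →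
      IsConj x (x' * y1 * y2⁻¹) := by
    intro x' y1 y2 h h1 h2
    have := mul_conj (x * y) y⁻¹ hcop2 _ _ (mul_conj x y hcop x' y1 h h1) (isConj_inv_inv h2)
    rwa [mul_inv_cancel_right] at this
  have key2 : ∀ x' y1 y2, IsConj x x' → IsConj y y1 → IsConj y y2 →
      IsConj x (y1 * y2⁻¹ * x') := by
    intro x' y1 y2 h h1 h2
    have := key x' _ _ h (isConj_conj x'⁻¹ _ _ h1) (isConj_conj x'⁻¹ _ _ h2)
    convert this using 1
    group
  have hmem : ∀ y1, IsConj y y1 → y1 * y⁻¹ ∈ leftStab x := by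
    intro y1 h1 z
    refine ⟨fun h => ?_, fun h => key2 z y1 y h h1 (IsConj.refl y)⟩
    have := key2 _ y y1 h (IsConj.refl y) h1
    convert this using 1
    group
  have hK : leftStab x ≤ Subgroup.centralizer {y} := by
    apply le_of_coprime_normal _ _ (leftStab_normal x)
    rw [← classSize_eq]
    exact hcop.coprime_dvd_left (leftStab_card x)
  apply hyc
  rw [Subgroup.mem_center_iff]
  intro g
  obtain ⟨b, hb⟩ := hyp
  have hc : IsConj y (g * y * g⁻¹) := isConj_conj g y y (IsConj.refl y)
  have hk := hmem _ hc
  generalize hkd : g * y * g⁻¹ * y⁻¹ = k at hk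
  have hcomm : Commute k y := Subgroup.mem_centralizer_singleton_iff.1 (hK hk)
  have hyb : y ^ p ^ b = 1 := by rw [← hb]; exact pow_orderOf_eq_one y
  have h1 : k ^ p ^ b = 1 := by
    have h2 : (k * y) ^ p ^ b = k ^ p ^ b * y ^ p ^ b := hcomm.mul_pow _
    rw [← hkd, inv_mul_cancel_right, conj_pow, hyb, mul_one, mul_one, mul_inv_cancel, hkd] at h2
    exact h2.symm
  have h2 : orderOf k ∣ classSize x :=
    (Subgroup.orderOf_dvd_natCard _ hk).trans (leftStab_card x)
  have h3 : Nat.Coprime (p ^ b) (classSize x) :=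
    Nat.Coprime.pow_left _ ((Nat.Prime.coprime_iff_not_dvd hp).2 hpx)
  have h4 : orderOf k = 1 := Nat.eq_one_of_dvd_coprimes h3 (orderOf_dvd_of_pow_eq_one h1) h2
  rw [orderOf_eq_one_iff] at h4
  rw [h4] at hkd
  exact mul_inv_eq_iff_eq_mul.1 (mul_inv_eq_one.1 hkd)

theorem classSize_ne_one {G : Type*} [Group G] (x : G) (hx : x ∉ Subgroup.center G) :
    classSize x ≠ 1 := by
  intro h
  rw [classSize_eq, Subgroup.index_eq_one] at h
  apply hx
  rw [Subgroup.mem_center_iff]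
  intro g
  exact Subgroup.mem_centralizer_singleton_iff.1 (h ▸ Subgroup.mem_top g)

theorem stmt10 {G : Type*} [Group G] [Finite G] (N : Subgroup G) (hN : N.Normal)
    (p : ℕ) (hp : p.Prime) (x y : G) (hx : x ∈ N) (hy : y ∈ N)
    (hxc : x ∉ Subgroup.center G) (hyc : y ∉ Subgroup.center G)
    (hxp : ∃ a : ℕ, orderOf x = p ^ a) (hyp : ∃ b : ℕ, orderOf y = p ^ b)
    (hcl : ∀ z ∈ N, Nat.Coprime (classSize z) (classSize x) ∨
      Nat.Coprime (classSize z) (classSize y)) :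
    p ∣ classSize x ∨ p ∣ classSize y := by
  have hx1 := classSize_ne_one x hxc
  have hcop : Nat.Coprime (classSize x) (classSize y) := by
    rcases hcl x hx with h | h
    · exact absurd ((Nat.coprime_self _).1 h) hx1
    · exact h
  rcases lt_trichotomy (classSize x) (classSize y) with h | h | h
  · exact Or.inr (main_aux N p hp y x hy hx hxc hxp hcop.symm h fun z hz => (hcl z hz).symm)
  · rw [← h] at hcop
    exact absurd ((Nat.coprime_self _).1 hcop) hx1
  · exact Or.inl (main_aux N p hp x y hx hy hyc hyp hcop h hcl)
end
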